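/- (Formula (4.3), prolongation module structure for H(2r)) Let r ≥ 1 and let V be a module over the Lie algebra sp(2r,F), with action written (M,v) ↦ M•v. For f ∈ P_{2r}, let A(f) ∈ M_{2r}(P_{2r}) be the matrix with entries A(f)_{j,i} = σ(i′)·∂_j∂_{i′}(f), and write A(f) = Σ_{β∈ℕ^{2r}} x^β·A_β with coefficient matrices A_β ∈ M_{2r}(F). Then each A_β lies in sp(2r,F), and setting ρ(D_H(f))(g ⊗ v) = D_H(f)(g) ⊗ v + Σ_β (x^β·g) ⊗ (A_β•v) yields a well-defined map ρ on H(2r) (i.e., ρ(D_H(f)) depends only on the derivation D_H(f), not on f) satisfying ρ([D,E]) = ρ(D)∘ρ(E) − ρ(E)∘ρ(D) for all D,E ∈ H(2r); i.e., ρ makes P_{2r} ⊗_F V into a module over the Lie algebra H(2r). -/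

import Mathlib

open MvPolynomial Matrix TensorProduct

noncomputable section

abbrev Wn (F : Type*) [Field F] (n : ℕ) :=
  Derivation F (MvPolynomial (Fin n) F) (MvPolynomial (Fin n) F)

/-- `σ(i) = 1` for `i ≤ r`, `σ(i) = -1` for `i > r` (indices `0,…,2r-1` here). -/
def sgn (F : Type*) [Field F] (r : ℕ) (i : Fin (2 * r)) : F :=
  if (i : ℕ) < r then 1 else -1

/-- `i ↦ i′`, i.e. `i + r` for `i ≤ r` and `i - r` for `i > r`. -/
def prime (r : ℕ) (i : Fin (2 * r)) : Fin (2 * r) :=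
  if h : (i : ℕ) < r then ⟨(i : ℕ) + r, by omega⟩
  else ⟨(i : ℕ) - r, by have := i.isLt; omega⟩

/-- The Hamiltonian vector field `D_H(f) = ∑ σ(i)·∂_i(f)·∂_{i′}`. -/
def DH {F : Type*} [Field F] {r : ℕ} (f : MvPolynomial (Fin (2 * r)) F) : Wn F (2 * r) :=
  ∑ i : Fin (2 * r), (sgn F r i • (pderiv i f)) • (pderiv (prime r i) : Wn F (2 * r))

/-- The standard symplectic matrix `J` (over `F`). -/
def Jmat (F : Type*) [Field F] (r : ℕ) : Matrix (Fin (2 * r)) (Fin (2 * r)) F :=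
  Matrix.of fun i j =>
    if (i : ℕ) + r = (j : ℕ) then 1 else if (j : ℕ) + r = (i : ℕ) then -1 else 0

/-- The matrix `A(f)` over `P_{2r}`, with entries `A(f)_{j,i} = σ(i′)·∂_j∂_{i′}(f)`. -/
def Amat {F : Type*} [Field F] {r : ℕ} (f : MvPolynomial (Fin (2 * r)) F) :
    Matrix (Fin (2 * r)) (Fin (2 * r)) (MvPolynomial (Fin (2 * r)) F) :=
  Matrix.of fun j i => sgn F r (prime r i) • pderiv j (pderiv (prime r i) f)

/-- The coefficient matrix `A_β ∈ M_{2r}(F)` in the expansion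
`A(f) = ∑_β x^β · A_β`. -/
def Acoeff {F : Type*} [Field F] {r : ℕ} (f : MvPolynomial (Fin (2 * r)) F)
    (β : Fin (2 * r) →₀ ℕ) : Matrix (Fin (2 * r)) (Fin (2 * r)) F :=
  Matrix.of fun j i => coeff β (Amat f j i)

section HamiltonianAlgebra

variable {F : Type*} [Field F] {r : ℕ}

lemma prime_prime (i : Fin (2 * r)) : prime r (prime r i) = i := by
  have := i.isLt
  ext
  by_cases hi : (i : ℕ) < r
  · simp [prime, hi]
  · have h : (i : ℕ) - r < r := by omega
    simp only [prime, hi, h, dif_pos, dif_neg, not_false_eq_true]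
    omega

lemma sgn_prime (i : Fin (2 * r)) : sgn F r (prime r i) = -sgn F r i := by
  have := i.isLt
  have h : (prime r i : ℕ) < r ↔ ¬ (i : ℕ) < r := by
    unfold prime
    split_ifs <;> simp only <;> omega
  by_cases hi : (i : ℕ) < r <;> simp [sgn, h, hi]

lemma sum_comp_prime {M : Type*} [AddCommMonoid M] (φ : Fin (2 * r) → M) :
    ∑ i, φ (prime r i) = ∑ i, φ i :=
  Equiv.sum_comp ⟨prime r, prime r, prime_prime, prime_prime⟩ φ

lemma Jmat_apply (i j : Fin (2 * r)) :
    Jmat F r i j = if j = prime r i then sgn F r i else 0 := by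
  have := i.isLt
  have := j.isLt
  simp only [Jmat, Matrix.of_apply, sgn, prime, Fin.ext_iff]
  by_cases hi : (i : ℕ) < r
  · have h : ¬ (j : ℕ) + r = i := by omega
    simp only [hi, h, dif_pos, if_true, if_false, eq_comm]
  · have h : ¬ (i : ℕ) + r = j := by omega
    have h' : (j : ℕ) + r = i ↔ (j : ℕ) = i - r := by omega
    simp only [hi, h, h', dif_neg, not_false_eq_true, if_false]

lemma derivation_sum_apply {σ R ι : Type*} [CommRing R] (s : Finset ι)
    (D : ι → Derivation R (MvPolynomial σ R) (MvPolynomial σ R)) (p : MvPolynomial σ R) :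
    (∑ i ∈ s, D i) p = ∑ i ∈ s, D i p := by
  rw [← Derivation.coeFnAddMonoidHom_apply, map_sum, Finset.sum_apply]
  rfl

lemma DH_apply (f g : MvPolynomial (Fin (2 * r)) F) :
    DH f g = ∑ i, sgn F r i • (pderiv i f * pderiv (prime r i) g) := by
  simp [DH, derivation_sum_apply]

lemma DH_apply_X (f : MvPolynomial (Fin (2 * r)) F) (i : Fin (2 * r)) :
    DH f (X i) = sgn F r (prime r i) • pderiv (prime r i) f := by
  rw [DH_apply, ← sum_comp_prime, Finset.sum_eq_single i]
  · simp [prime_prime]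
  · intro b _ hb
    simp [prime_prime, pderiv_X_of_ne hb.symm]
  · simp

lemma DH_apply_swap (f g : MvPolynomial (Fin (2 * r)) F) : DH f g = -DH g f := by
  rw [DH_apply, DH_apply, ← sum_comp_prime, ← Finset.sum_neg_distrib]
  refine Finset.sum_congr rfl fun i _ => ?_
  rw [sgn_prime, prime_prime, neg_smul, mul_comm (pderiv (prime r i) f)]

lemma pderiv_comm {σ R : Type*} [CommRing R] (i j : σ) (f : MvPolynomial σ R) :
    pderiv i (pderiv j f) = pderiv j (pderiv i f) := by
  classical
  have h : ⁅(pderiv i : Derivation R (MvPolynomial σ R) (MvPolynomial σ R)),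
      (pderiv j : Derivation R (MvPolynomial σ R) (MvPolynomial σ R))⁆ = 0 := by
    refine MvPolynomial.derivation_ext fun k => ?_
    simp [Derivation.commutator_apply, pderiv_X, Pi.single_apply, apply_ite]
  have := congrArg (fun D => D f) h
  simpa [Derivation.commutator_apply, sub_eq_zero] using this

lemma pderiv_DH_apply (j : Fin (2 * r)) (f g : MvPolynomial (Fin (2 * r)) F) :
    pderiv j (DH f g) = DH f (pderiv j g) - DH g (pderiv j f) := by
  rw [DH_apply_swap g, sub_neg_eq_add, DH_apply, DH_apply, DH_apply, map_sum,
    ← Finset.sum_add_distrib]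
  refine Finset.sum_congr rfl fun i _ => ?_
  rw [Derivation.map_smul, Derivation.leibniz, pderiv_comm j, pderiv_comm j, smul_add,
    smul_eq_mul, smul_eq_mul, mul_comm (pderiv (prime r i) g)]

/-- The Hamiltonian vector field of a Poisson bracket is the Lie bracket. -/
lemma DH_DH_apply (f g : MvPolynomial (Fin (2 * r)) F) : DH (DH f g) = ⁅DH f, DH g⁆ := by
  refine MvPolynomial.derivation_ext fun i => ?_
  rw [Derivation.commutator_apply, DH_apply_X, DH_apply_X, DH_apply_X, pderiv_DH_apply,
    Derivation.map_smul, Derivation.map_smul, smul_sub]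

lemma Amat_apply (f : MvPolynomial (Fin (2 * r)) F) (j i : Fin (2 * r)) :
    Amat f j i = pderiv j (DH f (X i)) := by
  rw [DH_apply_X, Derivation.map_smul]
  rfl

lemma Acoeff_apply (f : MvPolynomial (Fin (2 * r)) F) (β : Fin (2 * r) →₀ ℕ)
    (j i : Fin (2 * r)) :
    Acoeff f β j i = sgn F r (prime r i) * coeff β (pderiv j (pderiv (prime r i) f)) := by
  simp [Acoeff, Amat]

lemma Acoeff_symplectic (f : MvPolynomial (Fin (2 * r)) F) (β : Fin (2 * r) →₀ ℕ) :
    (Acoeff f β)ᵀ * Jmat F r + Jmat F r * Acoeff f β = 0 := by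
  ext k i
  have h (l : Fin (2 * r)) : i = prime r l ↔ l = prime r i :=
    ⟨fun h => by rw [h, prime_prime], fun h => by rw [h, prime_prime]⟩
  simp only [Matrix.add_apply, Matrix.mul_apply, Matrix.transpose_apply, Jmat_apply, h,
    mul_ite, ite_mul, mul_zero, zero_mul, Finset.sum_ite_eq', Finset.mem_univ, if_true,
    Acoeff_apply, Matrix.zero_apply]
  rw [pderiv_comm (prime r k), sgn_prime k]
  ring

lemma Acoeff_eq_of_DH_eq {f g : MvPolynomial (Fin (2 * r)) F} (h : DH f = DH g)
    (β : Fin (2 * r) →₀ ℕ) : Acoeff f β = Acoeff g β := by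
  ext j i
  simp only [Acoeff, Matrix.of_apply, Amat_apply, h]

end HamiltonianAlgebra

section Prolongation

variable {F : Type*} [Field F] {σ : Type*}

/-- The chain rule for a derivation applied before a partial derivative. -/
lemma pderiv_derivation_apply [Fintype σ]
    (D : Derivation F (MvPolynomial σ F) (MvPolynomial σ F)) (j : σ) (p : MvPolynomial σ F) :
    pderiv j (D p) = D (pderiv j p) + ∑ k, pderiv j (D (X k)) * pderiv k p := by
  classical
  let E : Derivation F (MvPolynomial σ F) (MvPolynomial σ F) :=
    ∑ k, pderiv j (D (X k)) • pderiv k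
  have h : ⁅(pderiv j : Derivation F (MvPolynomial σ F) (MvPolynomial σ F)), D⁆ = E := by
    refine MvPolynomial.derivation_ext fun k => ?_
    simp [E, Derivation.commutator_apply, derivation_sum_apply, pderiv_X, Pi.single_apply,
      apply_ite]
  have h' := congrArg (fun D => D p) h
  simpa [E, Derivation.commutator_apply, derivation_sum_apply, sub_eq_iff_eq_add'] using h'

variable {n : Type*} [Fintype n] [DecidableEq n] {V : Type*} [AddCommGroup V] [Module F V]

/-- The action on `P ⊗ V` of matrices over the polynomial ring `P`, induced by a linear action
on `V` of matrices over `F`. -/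
def matrixAction (π : Matrix n n F →ₗ[F] Module.End F V) :
    Matrix n n (MvPolynomial σ F) →ₗ[F] Module.End F (MvPolynomial σ F ⊗[F] V) where
  toFun A := ∑ j, ∑ i,
    TensorProduct.map (LinearMap.mul F _ (A j i)) (π (Matrix.single j i 1))
  map_add' A B := by
    simp only [Matrix.add_apply, map_add, TensorProduct.map_add_left,
      Finset.sum_add_distrib]
  map_smul' c A := by
    simp only [Matrix.smul_apply, map_smul, TensorProduct.map_smul_left, Finset.smul_sum,
      RingHom.id_apply]

lemma matrixAction_apply (π : Matrix n n F →ₗ[F] Module.End F V)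
    (A : Matrix n n (MvPolynomial σ F)) :
    matrixAction π A = ∑ j, ∑ i,
      TensorProduct.map (LinearMap.mul F _ (A j i)) (π (Matrix.single j i 1)) := rfl

lemma matrixAction_smul_map_C (π : Matrix n n F →ₗ[F] Module.End F V) (p : MvPolynomial σ F)
    (M : Matrix n n F) :
    matrixAction π (p • M.map C) = TensorProduct.map (LinearMap.mul F _ p) (π M) := by
  have h (j i : n) : Matrix.single j i (M j i) = M j i • Matrix.single j i (1 : F) := by simp
  conv_rhs => rw [Matrix.matrix_eq_sum_single M]
  refine TensorProduct.ext' fun g v => ?_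
  simp only [h, matrixAction_apply, map_sum, map_smul, LinearMap.sum_apply,
    TensorProduct.map_tmul, LinearMap.smul_apply, TensorProduct.tmul_sum, TensorProduct.tmul_smul,
    Matrix.smul_apply, Matrix.map_apply, LinearMap.mul_apply', smul_eq_mul,
    TensorProduct.smul_tmul', mul_comm p, C_mul']

lemma matrixAction_map_derivation (π : Matrix n n F →ₗ[F] Module.End F V)
    (D : Derivation F (MvPolynomial σ F) (MvPolynomial σ F))
    (A : Matrix n n (MvPolynomial σ F)) :
    matrixAction π (A.map D) =
      TensorProduct.map (D : MvPolynomial σ F →ₗ[F] MvPolynomial σ F) LinearMap.id ∘ₗ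
          matrixAction π A -
        matrixAction π A ∘ₗ
          TensorProduct.map (D : MvPolynomial σ F →ₗ[F] MvPolynomial σ F) LinearMap.id := by
  refine TensorProduct.ext' fun g v => ?_
  simp [matrixAction_apply, LinearMap.sum_apply, TensorProduct.add_tmul, mul_comm,
    Finset.sum_add_distrib]

/-- `matrixAction π` preserves the bracket of two polynomial matrices if `π` preserves the brackets
of their coefficient matrices. -/
lemma matrixAction_lie_sum (π : Matrix n n F →ₗ[F] Module.End F V) {ι : Type*}
    (s t : Finset ι) (p q : ι → MvPolynomial σ F) (M N : ι → Matrix n n F)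
    (h : ∀ a b, π ⁅M a, N b⁆ = π (M a) ∘ₗ π (N b) - π (N b) ∘ₗ π (M a)) :
    matrixAction π ⁅∑ a ∈ s, p a • (M a).map (C (σ := σ)),
        ∑ b ∈ t, q b • (N b).map (C (σ := σ))⁆ =
      matrixAction π (∑ a ∈ s, p a • (M a).map (C (σ := σ))) ∘ₗ
          matrixAction π (∑ b ∈ t, q b • (N b).map (C (σ := σ))) -
        matrixAction π (∑ b ∈ t, q b • (N b).map (C (σ := σ))) ∘ₗ
          matrixAction π (∑ a ∈ s, p a • (M a).map (C (σ := σ))) := by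
  have hmap (a b : ι) : p a • (M a).map (C (σ := σ)) * q b • (N b).map (C (σ := σ)) -
      q b • (N b).map (C (σ := σ)) * p a • (M a).map (C (σ := σ)) =
        (p a * q b) • (⁅M a, N b⁆).map (C (σ := σ)) := by
    rw [Ring.lie_def, Matrix.map_sub C (map_sub C), Matrix.map_mul, Matrix.map_mul, smul_sub,
      smul_mul_smul_comm, smul_mul_smul_comm, mul_comm (q b)]
  rw [Ring.lie_def, Finset.sum_mul_sum, Finset.sum_mul_sum, Finset.sum_comm (s := t)]
  simp only [← Finset.sum_sub_distrib, hmap, map_sum, matrixAction_smul_map_C, h]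
  refine TensorProduct.ext' fun g v => ?_
  simp only [LinearMap.sum_apply, LinearMap.sub_apply, LinearMap.comp_apply, map_sum,
    TensorProduct.map_tmul, TensorProduct.tmul_sub, LinearMap.mul_apply']
  rw [Finset.sum_comm (s := t)]
  simp only [← Finset.sum_sub_distrib, mul_left_comm, mul_assoc]

end Prolongation

section HamiltonianModule

variable {F : Type*} [Field F] {r : ℕ}

lemma Amat_of_commutator {f g h : MvPolynomial (Fin (2 * r)) F} (H : DH h = ⁅DH f, DH g⁆) :
    Amat h = (Amat g).map (DH f) - (Amat f).map (DH g) + ⁅Amat f, Amat g⁆ := by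
  ext1 j i
  rw [Ring.lie_def]
  simp only [Matrix.add_apply, Matrix.sub_apply, Matrix.map_apply, Matrix.mul_apply, Amat_apply, H,
    Derivation.commutator_apply, map_sub]
  rw [pderiv_derivation_apply (DH f) j (DH g (X i)), pderiv_derivation_apply (DH g) j (DH f (X i))]
  ring

lemma Amat_eq_sum (f : MvPolynomial (Fin (2 * r)) F) (s : Finset (Fin (2 * r) →₀ ℕ))
    (hs : ∀ β ∉ s, Acoeff f β = 0) :
    Amat f = ∑ β ∈ s, monomial β (1 : F) • (Acoeff f β).map C := by
  ext j i γ
  have h : γ ∉ s → coeff γ (Amat f j i) = 0 := fun hγ => congrFun (congrFun (hs γ hγ) j) i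
  simp only [Matrix.sum_apply, Matrix.smul_apply, Matrix.map_apply, Acoeff, Matrix.of_apply,
    smul_eq_mul, coeff_sum, mul_comm _ (C _), coeff_C_mul, coeff_monomial, mul_ite, mul_one,
    mul_zero, Finset.sum_ite_eq']
  split_ifs with hγ
  · rfl
  · exact h hγ

lemma exists_Acoeff_support (f : MvPolynomial (Fin (2 * r)) F) :
    ∃ s : Finset (Fin (2 * r) →₀ ℕ), ∀ β ∉ s, Acoeff f β = 0 := by
  classical
  refine ⟨Finset.univ.biUnion fun j => Finset.univ.biUnion fun i => (Amat f j i).support,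
    fun β hβ => ?_⟩
  ext j i
  simp only [Finset.mem_biUnion, Finset.mem_univ, true_and, not_exists] at hβ
  exact notMem_support_iff.mp (hβ j i)

end HamiltonianModule

/-- formula (4.3): let `V` be an `sp(2r,F)`-module, with action
given by a linear map `π` into endomorphisms satisfying `π[M,N] = [π M, π N]`
for symplectic `M, N`.  Then every coefficient matrix `A_β` of `A(f)` lies in
`sp(2r,F)`; the prescription
`ρ(D_H(f))(g ⊗ v) = D_H(f)(g) ⊗ v + ∑_β (x^β·g) ⊗ (A_β•v)` is well defined
(the `A_β` depend only on the derivation `D_H(f)`); and a map `ρ` satisfying it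
obeys `ρ[D,E] = [ρ D, ρ E]` on `H(2r)`, i.e. makes `P_{2r} ⊗ V` an
`H(2r)`-module. -/
theorem stmt18 (F : Type*) [Field F] [CharZero F] (r : ℕ) (hr : 1 ≤ r)
    (V : Type*) [AddCommGroup V] [Module F V]
    (π : Matrix (Fin (2 * r)) (Fin (2 * r)) F →ₗ[F] Module.End F V)
    (hπ : ∀ M N : Matrix (Fin (2 * r)) (Fin (2 * r)) F,
      Mᵀ * Jmat F r + Jmat F r * M = 0 → Nᵀ * Jmat F r + Jmat F r * N = 0 →
      π ⁅M, N⁆ = π M ∘ₗ π N - π N ∘ₗ π M)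
    (ρ : Wn F (2 * r) → Module.End F (TensorProduct F (MvPolynomial (Fin (2 * r)) F) V))
    (hρ : ∀ (f : MvPolynomial (Fin (2 * r)) F) (s : Finset (Fin (2 * r) →₀ ℕ)),
      (∀ β ∉ s, Acoeff f β = 0) →
      ∀ (g : MvPolynomial (Fin (2 * r)) F) (v : V),
        ρ (DH f) (g ⊗ₜ[F] v) = (DH f g) ⊗ₜ[F] v +
          ∑ β ∈ s, ((monomial β (1 : F)) * g) ⊗ₜ[F] (π (Acoeff f β) v)) :
    (∀ (f : MvPolynomial (Fin (2 * r)) F) (β : Fin (2 * r) →₀ ℕ),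
      (Acoeff f β)ᵀ * Jmat F r + Jmat F r * Acoeff f β = 0) ∧
    (∀ f g : MvPolynomial (Fin (2 * r)) F, DH f = DH g →
      ∀ β, Acoeff f β = Acoeff g β) ∧
    (∀ f g : MvPolynomial (Fin (2 * r)) F,
      ρ ⁅DH f, DH g⁆ = ρ (DH f) ∘ₗ ρ (DH g) - ρ (DH g) ∘ₗ ρ (DH f)) := by
  refine ⟨Acoeff_symplectic, fun f g h => Acoeff_eq_of_DH_eq h, fun f g => ?_⟩
  have hact (f : MvPolynomial (Fin (2 * r)) F) : ρ (DH f) =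
      TensorProduct.map (DH f : MvPolynomial (Fin (2 * r)) F →ₗ[F] MvPolynomial (Fin (2 * r)) F)
          LinearMap.id +
        matrixAction π (Amat f) := by
    obtain ⟨s, hs⟩ := exists_Acoeff_support f
    refine TensorProduct.ext' fun p v => ?_
    rw [hρ f s hs, Amat_eq_sum f s hs, map_sum]
    simp [matrixAction_smul_map_C, LinearMap.sum_apply]
  have hlie : matrixAction π ⁅Amat f, Amat g⁆ =
      matrixAction π (Amat f) ∘ₗ matrixAction π (Amat g) -
      matrixAction π (Amat g) ∘ₗ matrixAction π (Amat f) := by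
    obtain ⟨s, hs⟩ := exists_Acoeff_support f
    obtain ⟨t, ht⟩ := exists_Acoeff_support g
    rw [Amat_eq_sum f s hs, Amat_eq_sum g t ht]
    exact matrixAction_lie_sum π s t _ _ _ _ fun β γ =>
      hπ _ _ (Acoeff_symplectic f β) (Acoeff_symplectic g γ)
  rw [← DH_DH_apply, hact, hact, hact, Amat_of_commutator (DH_DH_apply f g), DH_DH_apply,
    map_add, map_sub, hlie, matrixAction_map_derivation, matrixAction_map_derivation]
  refine TensorProduct.ext' fun p v => ?_
  simp only [LinearMap.add_apply, LinearMap.sub_apply, LinearMap.comp_apply, map_add,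
    TensorProduct.map_tmul, Derivation.coeFn_coe, LinearMap.id_apply, Derivation.commutator_apply,
    TensorProduct.sub_tmul]
  abel
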